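/- arXiv:1402.0834 — 2 statements merged into one kernel-verified Lean document; each statement's English description precedes it below -/
import Mathlib

section
/- Let d ≥ 2, k ≥ 4, and let u, v ∈ S^∞_k with ‖u−v‖₁ ≥ 2. Then there exist an integer m with k+1 ≤ m ≤ k+3, a path P_u starting at u, and a path P_v starting at v, such that: one of P_u, P_v ends at e_{m−1} and the other ends at −e_{m−1}; every vertex of P_u and of P_v lies in B^∞_{m−1} \ B^∞_{k−1}; and every vertex of P_u is at ℓ1-distance at least 2 from every vertex of P_v. -/
/-- The `ℓ1`-norm of a point of `ℤ^d`. -/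
def norm1 {d : ℕ} (x : Fin d → ℤ) : ℤ := ∑ i, |x i|

/-- Grid adjacency in `ℤ^d`: `u` and `v` are adjacent iff `‖u - v‖₁ = 1`. -/
def Adj {d : ℕ} (u v : Fin d → ℤ) : Prop := norm1 (u - v) = 1

/-- The `ℓ∞`-ball `B^∞_r = {v : ‖v‖_∞ ≤ r}` in `ℤ^d`. -/
def Binf (d : ℕ) (r : ℤ) : Set (Fin d → ℤ) := {x | ∀ i, |x i| ≤ r}

/-- The `ℓ∞`-sphere `S^∞_r = {v : ‖v‖_∞ = r}` in `ℤ^d`. -/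
def Sinf (d : ℕ) (r : ℤ) : Set (Fin d → ℤ) := {x | (∀ i, |x i| ≤ r) ∧ ∃ i, |x i| = r}

/-- The point `e_m = (m, 0, …, 0)` of `ℤ^d`. -/
def eVec (d : ℕ) (m : ℤ) : Fin d → ℤ := fun i => if (i : ℕ) = 0 then m else 0

open Function

/-- The grid graph restricted to the set `A`. -/
def gridOn {d : ℕ} (A : Set (Fin d → ℤ)) : SimpleGraph (Fin d → ℤ) where
  Adj x y := Adj x y ∧ x ∈ A ∧ y ∈ A
  symm := ⟨by
    rintro x y ⟨h, hx, hy⟩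
    refine ⟨?_, hy, hx⟩
    unfold Adj norm1 at *
    rw [← h]
    exact Finset.sum_congr rfl fun i _ => by simp only [Pi.sub_apply]; rw [abs_sub_comm]⟩
  loopless := ⟨by
    rintro x ⟨h, -, -⟩
    simp [Adj, norm1] at h⟩

theorem gridOn_mono {d : ℕ} {A B : Set (Fin d → ℤ)} (h : A ⊆ B) : gridOn A ≤ gridOn B := by
  intro x y hxy
  exact ⟨hxy.1, h hxy.2.1, h hxy.2.2⟩

theorem norm1_mono {d : ℕ} {a b : Fin d → ℤ} (h : ∀ j, |a j| ≤ |b j|) : norm1 a ≤ norm1 b :=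
  Finset.sum_le_sum fun i _ => h i

theorem abs_le_norm1 {d : ℕ} (a : Fin d → ℤ) (j : Fin d) : |a j| ≤ norm1 a :=
  Finset.single_le_sum (f := fun i => |a i|) (fun i _ => abs_nonneg _) (Finset.mem_univ j)

theorem adj_update {d : ℕ} (x : Fin d → ℤ) (i : Fin d) (a : ℤ) :
    Adj (update x i a) (update x i (a + 1)) := by
  unfold Adj norm1
  rw [Finset.sum_eq_single i]
  · simp
  · intro j _ hj
    simp [update_of_ne hj]
  · simp

theorem reach_seg_aux {d : ℕ} {A : Set (Fin d → ℤ)} (x : Fin d → ℤ) (i : Fin d) (a : ℤ) (n : ℕ)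
    (h : ∀ c, a ≤ c → c ≤ a + n → update x i c ∈ A) :
    (gridOn A).Reachable (update x i a) (update x i (a + n)) := by
  induction n with
  | zero => simp
  | succ n ih =>
    refine (ih fun c h1 h2 => h c h1 (by push_cast; omega)).trans ?_
    apply SimpleGraph.Adj.reachable
    refine ⟨?_, h _ (by omega) (by push_cast; omega), h _ (by omega) (by omega)⟩
    have := adj_update x i (a + n)
    push_cast
    rwa [← add_assoc]

theorem reach_seg {d : ℕ} {A : Set (Fin d → ℤ)} (x : Fin d → ℤ) (i : Fin d) (t : ℤ)
    (h : ∀ c, min (x i) t ≤ c → c ≤ max (x i) t → update x i c ∈ A) :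
    (gridOn A).Reachable x (update x i t) := by
  have key : ∀ a b : ℤ, a ≤ b → (∀ c, a ≤ c → c ≤ b → update x i c ∈ A) →
      (gridOn A).Reachable (update x i a) (update x i b) := by
    intro a b hab hc
    obtain ⟨n, rfl⟩ := Int.le.dest hab
    exact reach_seg_aux x i a n hc
  rcases le_total (x i) t with h1 | h1
  · have := key (x i) t h1 fun c h2 h3 => h c (by omega) (by omega)
    rwa [update_eq_self] at this
  · have := key t (x i) h1 fun c h2 h3 => h c (by omega) (by omega)
    rw [update_eq_self] at this
    exact this.symm

/-- A face of the cube is connected. -/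
theorem reach_face {d : ℕ} {A : Set (Fin d → ℤ)} (r : ℤ) (i : Fin d) (t : ℤ)
    (hA : ∀ x : Fin d → ℤ, x i = t → (∀ j, |x j| ≤ r) → x ∈ A)
    (x y : Fin d → ℤ) (hxi : x i = t) (hyi : y i = t) (hx : ∀ j, |x j| ≤ r)
    (hy : ∀ j, |y j| ≤ r) : (gridOn A).Reachable x y := by
  have key : ∀ T : Finset (Fin d),
      (gridOn A).Reachable x (fun j => if j ∈ T then y j else x j) := by
    intro T
    induction T using Finset.induction_on with
    | empty => simp
    | insert a T ha ih =>
      refine ih.trans ?_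
      have e : (fun j => if j ∈ insert a T then y j else x j) =
          update (fun j => if j ∈ T then y j else x j) a (y a) := by
        funext j
        by_cases hj : j = a
        · subst hj; simp
        · simp [update_of_ne hj, hj]
      rw [e]
      apply reach_seg
      intro c h1 h2
      simp only [ha, if_false] at h1 h2
      apply hA
      · by_cases hi : i = a
        · subst hi; simp; omega
        · rw [update_of_ne hi]; split_ifs <;> assumption
      · intro j
        by_cases hj : j = a
        · subst hj
          have := hx j
          have := hy j
          simp only [update_self]
          simp only [abs_eq_max_neg] at *
          omega
        · rw [update_of_ne hj]
          split_ifs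
          · exact hy j
          · exact hx j
  simpa using key Finset.univ

/-- The sphere of radius `r` without the closed neighbourhood of `w`. -/
def Rest (d : ℕ) (r : ℤ) (w : Fin d → ℤ) : Set (Fin d → ℤ) :=
  {x | x ∈ Sinf d r ∧ 2 ≤ norm1 (x - w)}

theorem rest_update {d : ℕ} {r : ℤ} {w x : Fin d → ℤ} {i j : Fin d} {c : ℤ}
    (hx : x ∈ Rest d r w) (hij : j ≠ i) (hj : |x j| = r) (hc : |c| ≤ r)
    (h : |x i - w i| ≤ |c - w i|) : update x i c ∈ Rest d r w := by
  refine ⟨⟨?_, j, by rwa [update_of_ne hij]⟩, hx.2.trans (norm1_mono ?_)⟩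
  · intro l
    by_cases hl : l = i
    · subst hl; simpa
    · rw [update_of_ne hl]; exact hx.1.1 l
  · intro l
    by_cases hl : l = i
    · subst hl; simpa
    · simp [update_of_ne hl]

theorem reach_to_face {d : ℕ} {r : ℤ} (hr : 1 ≤ r) (hd : 2 ≤ d) {w x : Fin d → ℤ} {i : Fin d}
    (hwr : ∀ j, |w j| ≤ r) (hw : |w i| = r) (hx : x ∈ Rest d r w) :
    ∃ y, y i = - w i ∧ (∀ j, |y j| ≤ r) ∧ (gridOn (Rest d r w)).Reachable x y := by
  -- first case: another coordinate is extremal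
  have main : ∀ x ∈ Rest d r w, ∀ j, j ≠ i → |x j| = r →
      ∃ y, y i = - w i ∧ (∀ j, |y j| ≤ r) ∧ (gridOn (Rest d r w)).Reachable x y := by
    intro x hx j hji hj
    have hxi := hx.1.1 i
    refine ⟨update x i (- w i), by simp, ?_, ?_⟩
    · intro l
      by_cases hl : l = i
      · subst hl; simp [hw]
      · rw [update_of_ne hl]; exact hx.1.1 l
    · apply reach_seg
      intro c h1 h2
      apply rest_update hx hji hj
      · simp only [abs_eq_max_neg] at *; omega
      · simp only [abs_eq_max_neg] at *; omega
  by_cases h : ∃ j, j ≠ i ∧ |x j| = r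
  · obtain ⟨j, h1, h2⟩ := h
    exact main x hx j h1 h2
  push Not at h
  have hxi : |x i| = r := by
    obtain ⟨j, hj⟩ := hx.1.2
    by_cases hji : j = i
    · rwa [hji] at hj
    · exact absurd hj (h j hji)
  by_cases hs : x i = - w i
  · exact ⟨x, hs, hx.1.1, SimpleGraph.Reachable.refl _⟩
  have hs' : x i = w i := by simp only [abs_eq_max_neg] at *; omega
  obtain ⟨j, hj⟩ : ∃ j, x j ≠ w j := by
    by_contra hcon
    push Not at hcon
    have h2 := hx.2
    have : x = w := funext hcon
    simp [this, norm1] at h2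
  have hji : j ≠ i := by rintro rfl; exact hj hs'
  have hxj := hx.1.1 j
  have hwj := hwr j
  obtain ⟨t, ht, htm⟩ : ∃ t : ℤ, |t| = r ∧ ∀ c, min (x j) t ≤ c → c ≤ max (x j) t →
      |c| ≤ r ∧ |x j - w j| ≤ |c - w j| := by
    rcases lt_or_gt_of_ne hj with h1 | h1
    · refine ⟨-r, by simp only [abs_eq_max_neg] at *; omega, fun c h2 h3 => ⟨?_, ?_⟩⟩ <;>
      · simp only [abs_eq_max_neg] at *; omega
    · refine ⟨r, by simp only [abs_eq_max_neg] at *; omega, fun c h2 h3 => ⟨?_, ?_⟩⟩ <;>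
      · simp only [abs_eq_max_neg] at *; omega
  have step : ∀ c, min (x j) t ≤ c → c ≤ max (x j) t → update x j c ∈ Rest d r w :=
    fun c h1 h2 => rest_update hx hji.symm hxi (htm c h1 h2).1 (htm c h1 h2).2
  obtain ⟨y, hy1, hy2, hy3⟩ := main (update x j t) (step t (by omega) (by omega)) j hji
    (by simpa using ht)
  exact ⟨y, hy1, hy2, (reach_seg x j t step).trans hy3⟩

theorem reach_rest {d : ℕ} {r : ℤ} (hr : 1 ≤ r) (hd : 2 ≤ d) {w x y : Fin d → ℤ}
    (hw : w ∈ Sinf d r) (hx : x ∈ Rest d r w) (hy : y ∈ Rest d r w) :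
    (gridOn (Rest d r w)).Reachable x y := by
  obtain ⟨hwr, i, hi⟩ := hw
  obtain ⟨x', hx1, hx2, hx3⟩ := reach_to_face hr hd hwr hi hx
  obtain ⟨y', hy1, hy2, hy3⟩ := reach_to_face hr hd hwr hi hy
  refine hx3.trans (SimpleGraph.Reachable.trans ?_ hy3.symm)
  refine reach_face r i (- w i) ?_ x' y' hx1 hy1 hx2 hy2
  intro z hz hzr
  refine ⟨⟨hzr, i, by rw [hz, abs_neg, hi]⟩, le_trans ?_ (abs_le_norm1 _ i)⟩
  simp only [Pi.sub_apply]
  simp only [abs_eq_max_neg] at *; omega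

theorem exists_list {d : ℕ} {A : Set (Fin d → ℤ)} {x y : Fin d → ℤ}
    (h : (gridOn A).Reachable x y) (hx : x ∈ A) :
    ∃ (P : List (Fin d → ℤ)) (hP : P ≠ []), P.Nodup ∧ P.IsChain Adj ∧ P.head hP = x ∧
      P.getLast hP = y ∧ ∀ z ∈ P, z ∈ A := by
  classical
  obtain ⟨p, hp⟩ := h.exists_isPath
  refine ⟨p.support, p.support_ne_nil, hp.support_nodup, ?_, by simp, by simp, ?_⟩
  · exact p.isChain_adj_support.imp fun a b hab => hab.1
  · clear hp
    induction p with
    | nil => simpa using hx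
    | cons hadj q ih =>
      intro z hz
      simp only [SimpleGraph.Walk.support_cons, List.mem_cons] at hz
      rcases hz with rfl | hz
      · exact hx
      · exact ih ⟨q⟩ hadj.2.2 z hz

theorem eVec_eq_update (d : ℕ) (hd : 0 < d) (a : ℤ) :
    eVec d a = update (fun _ => 0) (⟨0, hd⟩ : Fin d) a := by
  funext j
  by_cases hj : j = ⟨0, hd⟩
  · subst hj; simp [eVec]
  · have : (j : ℕ) ≠ 0 := fun h => hj (Fin.ext h)
    simp [eVec, this, update_of_ne hj]

theorem eVec_mem {d : ℕ} (hd : 0 < d) (a r : ℤ) (h : |a| = r) : eVec d a ∈ Sinf d r := by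
  refine ⟨fun j => ?_, ⟨0, hd⟩, by simpa [eVec]⟩
  unfold eVec
  have := abs_nonneg a
  split_ifs
  · exact h.le
  · simp; omega

/-- The core construction, with a sign `s` such that `s * e_k` is far from `u`. -/
theorem core (d : ℕ) (hd : 2 ≤ d) (k : ℤ) (hk : 4 ≤ k)
    (u v : Fin d → ℤ) (hu : u ∈ Sinf d k) (hv : v ∈ Sinf d k)
    (huv : 2 ≤ norm1 (u - v)) (s : ℤ) (hs : s = 1 ∨ s = -1)
    (hus : 2 ≤ norm1 (u - eVec d (s * k))) :
    ∃ A B : Set (Fin d → ℤ), u ∈ A ∧ v ∈ B ∧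
      (gridOn A).Reachable u (eVec d (-s * (k + 2))) ∧
      (gridOn B).Reachable v (eVec d (s * (k + 2))) ∧
      (∀ x ∈ A, x ∈ Binf d (k + 2) ∧ x ∉ Binf d (k - 1)) ∧
      (∀ x ∈ B, x ∈ Binf d (k + 2) ∧ x ∉ Binf d (k - 1)) ∧
      (∀ x ∈ A, ∀ y ∈ B, 2 ≤ norm1 (x - y)) := by
  have hd0 : 0 < d := by omega
  have sphere : ∀ r, k ≤ r → r ≤ k + 2 → ∀ x ∈ Sinf d r,
      x ∈ Binf d (k + 2) ∧ x ∉ Binf d (k - 1) := by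
    rintro r h1 h2 x ⟨hx, i, hi⟩
    refine ⟨fun j => (hx j).trans h2, fun h => ?_⟩
    have := h i
    omega
  obtain ⟨hur, i, hi⟩ := hu
  obtain ⟨σ, hσ, hui⟩ : ∃ σ : ℤ, (σ = 1 ∨ σ = -1) ∧ u i = σ * k := by
    rcases abs_cases (u i) with h | h
    · exact ⟨1, Or.inl rfl, by omega⟩
    · exact ⟨-1, Or.inr rfl, by omega⟩
  -- the points obtained by pushing `u` outwards
  have push_mem : ∀ a, 0 ≤ a → update u i (σ * (k + a)) ∈ Sinf d (k + a) := by
    intro a ha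
    have e : |σ * (k + a)| = k + a := by
      rcases hσ with rfl | rfl <;> simp only [abs_eq_max_neg] <;> omega
    refine ⟨fun j => ?_, i, by simpa using e⟩
    by_cases hj : j = i
    · subst hj; simp [e]
    · rw [update_of_ne hj]; have := hur j; omega
  have push_far : ∀ a, 0 ≤ a → ∀ y : Fin d → ℤ, (∀ j, |y j| ≤ k) → 2 ≤ norm1 (u - y) →
      2 ≤ norm1 (update u i (σ * (k + a)) - y) := by
    intro a ha y hy h
    refine h.trans (norm1_mono fun j => ?_)
    by_cases hj : j = i
    · subst hj
      have := hy j
      simp only [Pi.sub_apply, update_self, hui]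
      rcases hσ with rfl | rfl <;> simp only [abs_eq_max_neg] at * <;> omega
    · simp [update_of_ne hj]
  have push_e : ∀ a b, 0 ≤ a → 0 ≤ b →
      2 ≤ norm1 (update u i (σ * (k + a)) - eVec d (s * (k + b))) := by
    intro a b ha hb
    by_cases h0 : (i : ℕ) = 0
    · refine hus.trans (norm1_mono fun j => ?_)
      by_cases hj : j = i
      · subst hj
        simp only [Pi.sub_apply, update_self, hui, eVec, h0, if_true]
        rcases hσ with rfl | rfl <;> rcases hs with rfl | rfl <;>
          simp only [abs_eq_max_neg] at * <;> omega
      · have : (j : ℕ) ≠ 0 := fun h => hj (Fin.ext (h.trans h0.symm))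
        simp [update_of_ne hj, eVec, this]
    · refine le_trans ?_ (abs_le_norm1 _ i)
      simp only [Pi.sub_apply, update_self, eVec, h0, if_false]
      rcases hσ with rfl | rfl <;> simp only [abs_eq_max_neg] at * <;> omega
  have uz : update u i (σ * (k + 0)) = u := by
    rw [add_zero, ← hui, update_eq_self]
  have abs_s : ∀ a, 0 ≤ a → |s * a| = a := by
    intro a ha
    rcases hs with rfl | rfl <;> simp only [abs_eq_max_neg] <;> omega
  have e_mem : ∀ a, 0 ≤ a → eVec d (s * (k + a)) ∈ Sinf d (k + a) := fun a ha =>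
    eVec_mem hd0 _ _ (abs_s _ (by omega))
  have hE2 : eVec d (-s * (k + 2)) ∈ Rest d (k + 2) (eVec d (s * (k + 2))) := by
    refine ⟨eVec_mem hd0 _ _ ?_, le_trans ?_ (abs_le_norm1 _ ⟨0, hd0⟩)⟩
    · rw [neg_mul, abs_neg]; exact abs_s _ (by omega)
    · simp only [Pi.sub_apply, eVec, if_true]
      rcases hs with rfl | rfl <;> simp only [abs_eq_max_neg] at * <;> omega
  have comm : ∀ x y : Fin d → ℤ, norm1 (x - y) = norm1 (y - x) := fun x y =>
    Finset.sum_congr rfl fun j _ => abs_sub_comm _ _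
  let A : Set (Fin d → ℤ) := {x | (∃ a, 0 ≤ a ∧ a ≤ 2 ∧ x = update u i (σ * (k + a))) ∨
    x ∈ Rest d (k + 2) (eVec d (s * (k + 2)))}
  let B : Set (Fin d → ℤ) := {x | x ∈ Rest d k u ∨
    ∃ b, 0 ≤ b ∧ b ≤ 2 ∧ x = eVec d (s * (k + b))}
  refine ⟨A, B, Or.inl ⟨0, le_rfl, by omega, uz.symm⟩, Or.inl ⟨hv, by rwa [comm]⟩, ?_, ?_, ?_,
    ?_, ?_⟩
  · have h1 : (gridOn A).Reachable u (update u i (σ * (k + 2))) := by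
      apply reach_seg
      intro c h1 h2
      refine Or.inl ⟨σ * c - k, ?_⟩
      rw [hui] at h1 h2
      rcases hσ with rfl | rfl
      · refine ⟨by omega, by omega, ?_⟩
        congr 1; ring
      · refine ⟨by omega, by omega, ?_⟩
        congr 1; ring
    refine h1.trans (SimpleGraph.Reachable.mono (gridOn_mono (fun x hx => Or.inr hx))
      (reach_rest (by omega) hd (e_mem 2 (by omega))
        ⟨push_mem 2 (by omega), push_e 2 2 (by omega) (by omega)⟩ hE2))
  · have hek : eVec d (s * k) ∈ Rest d k u := by
      have := e_mem 0 le_rfl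
      rw [add_zero] at this
      exact ⟨this, by rwa [comm]⟩
    have h1 : (gridOn B).Reachable v (eVec d (s * k)) :=
      SimpleGraph.Reachable.mono (gridOn_mono (fun x hx => Or.inl hx))
        (reach_rest (by omega) hd ⟨hur, i, hi⟩ ⟨hv, by rwa [comm]⟩ hek)
    refine h1.trans ?_
    have e2 : eVec d (s * (k + 2)) = update (eVec d (s * k)) ⟨0, hd0⟩ (s * (k + 2)) := by
      simp [eVec_eq_update d hd0]
    rw [e2]
    apply reach_seg
    intro c h1 h2
    have e0 : eVec d (s * k) ⟨0, hd0⟩ = s * k := by simp [eVec]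
    rw [e0] at h1 h2
    refine Or.inr ⟨s * c - k, ?_⟩
    rw [eVec_eq_update d hd0, eVec_eq_update d hd0, update_idem]
    rcases hs with rfl | rfl
    · refine ⟨by omega, by omega, ?_⟩
      congr 1; ring
    · refine ⟨by omega, by omega, ?_⟩
      congr 1; ring
  · rintro x (⟨a, ha, ha2, rfl⟩ | hx)
    · exact sphere (k + a) (by omega) (by omega) _ (push_mem a ha)
    · exact sphere (k + 2) (by omega) (by omega) _ hx.1
  · rintro x (hx | ⟨b, hb, hb2, rfl⟩)
    · exact sphere k (by omega) (by omega) _ hx.1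
    · exact sphere (k + b) (by omega) (by omega) _ (e_mem b hb)
  · rintro x (⟨a, ha, ha2, rfl⟩ | hx) y (hy | ⟨b, hb, hb2, rfl⟩)
    · exact push_far a ha y hy.1.1 (by rw [comm]; exact hy.2)
    · exact push_e a b ha hb
    · obtain ⟨j, hj⟩ := hx.1.2
      refine le_trans ?_ (abs_le_norm1 _ j)
      have := hy.1.1 j
      simp only [Pi.sub_apply]
      simp only [abs_eq_max_neg] at *; omega
    · obtain ⟨⟨hxr, j, hj⟩, hx2⟩ := hx
      by_cases h0 : (j : ℕ) = 0
      · by_cases hxs : x j = s * (k + 2)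
        · refine hx2.trans (norm1_mono fun l => ?_)
          by_cases hl : l = j
          · subst hl
            simp [eVec, h0, hxs]
          · have : (l : ℕ) ≠ 0 := fun h => hl (Fin.ext (h.trans h0.symm))
            simp [eVec, this]
        · refine le_trans ?_ (abs_le_norm1 _ j)
          simp only [Pi.sub_apply, eVec, h0, if_true]
          rcases hs with rfl | rfl <;> simp only [abs_eq_max_neg] at * <;> omega
      · refine le_trans ?_ (abs_le_norm1 _ j)
        simp only [Pi.sub_apply, eVec, h0, if_false]
        simp only [abs_eq_max_neg] at *; omega


theorem statement8 (d : ℕ) (hd : 2 ≤ d) (k : ℤ) (hk : 4 ≤ k)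
    (u v : Fin d → ℤ) (hu : u ∈ Sinf d k) (hv : v ∈ Sinf d k)
    (huv : 2 ≤ norm1 (u - v)) :
    ∃ m : ℤ, k + 1 ≤ m ∧ m ≤ k + 3 ∧
      ∃ (Pu Pv : List (Fin d → ℤ)) (hPu : Pu ≠ []) (hPv : Pv ≠ []),
        Pu.Nodup ∧ Pu.Chain' Adj ∧ Pv.Nodup ∧ Pv.Chain' Adj ∧
        Pu.head hPu = u ∧ Pv.head hPv = v ∧
        ((Pu.getLast hPu = eVec d (m - 1) ∧ Pv.getLast hPv = eVec d (-(m - 1))) ∨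
          (Pu.getLast hPu = eVec d (-(m - 1)) ∧ Pv.getLast hPv = eVec d (m - 1))) ∧
        (∀ x ∈ Pu, x ∈ Binf d (m - 1) ∧ x ∉ Binf d (k - 1)) ∧
        (∀ x ∈ Pv, x ∈ Binf d (m - 1) ∧ x ∉ Binf d (k - 1)) ∧
        (∀ x ∈ Pu, ∀ y ∈ Pv, 2 ≤ norm1 (x - y)) := by
  have hd0 : 0 < d := by omega
  have hu0 := hu.1 ⟨0, hd0⟩
  obtain ⟨s, hs, hus⟩ : ∃ s : ℤ, (s = 1 ∨ s = -1) ∧ 2 ≤ norm1 (u - eVec d (s * k)) := by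
    rcases le_total 0 (u ⟨0, hd0⟩) with h | h
    · refine ⟨-1, Or.inr rfl, le_trans ?_ (abs_le_norm1 _ ⟨0, hd0⟩)⟩
      simp only [Pi.sub_apply, eVec, if_true]
      simp only [abs_eq_max_neg] at *; omega
    · refine ⟨1, Or.inl rfl, le_trans ?_ (abs_le_norm1 _ ⟨0, hd0⟩)⟩
      simp only [Pi.sub_apply, eVec, if_true]
      simp only [abs_eq_max_neg] at *; omega
  obtain ⟨A, B, huA, hvB, hRu, hRv, hA, hB, hAB⟩ := core d hd k hk u v hu hv huv s hs hus
  obtain ⟨Pu, hPu, nu, cu, hhu, lu, mu⟩ := exists_list hRu huA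
  obtain ⟨Pv, hPv, nv, cv, hhv, lv, mv⟩ := exists_list hRv hvB
  have ek : k + 3 - 1 = k + 2 := by ring
  refine ⟨k + 3, by omega, le_rfl, Pu, Pv, hPu, hPv, nu, cu, nv, cv, hhu, hhv, ?_, ?_, ?_, ?_⟩
  · rw [ek, lu, lv]
    rcases hs with rfl | rfl
    · right; constructor <;> congr 1 <;> ring
    · left; constructor <;> congr 1 <;> ring
  · rw [ek]; exact fun x hx => hA x (mu x hx)
  · rw [ek]; exact fun x hx => hB x (mv x hx)
  · exact fun x hx y hy => hAB x (mu x hx) y (mv y hy)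
end

section
/- For every integer m > 0 there exists an integer r > m with the following property. Let P be an induced path in the triangular lattice T passing through the origin (0,0) whose two endpoints a and b both lie outside B_{r+2} (the graph-distance ball of radius r+2 around the origin in T). Then there exists a set S ⊆ ℤ² of vertices such that: S agrees with the vertex set of P outside B_r (i.e. S \ B_r = P \ B_r); S ∩ B_m = {(i,0) : −m ≤ i ≤ m}; a and b are joined by a path in T all of whose vertices lie in S; and every path in T with all vertices in S joining a to b passes through (0,0). -/
/-- Adjacency in the triangular lattice `T` on vertex set `ℤ²`. -/
def AdjT (u v : ℤ × ℤ) : Prop :=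
  u - v ∈ ({(1, 0), (-1, 0), (0, 1), (0, -1), (1, 1), (-1, -1)} : Set (ℤ × ℤ))

/-- `v` lies in the ball `B_k`: the graph distance in `T` from `v` to the origin is
at most `k`, i.e. there is a walk from `v` to `(0,0)` in `T` with at most `k` steps. -/
def InBallT (v : ℤ × ℤ) (k : ℤ) : Prop :=
  ∃ (L : List (ℤ × ℤ)) (h : L ≠ []),
    L.Chain' AdjT ∧ L.head h = v ∧ L.getLast h = 0 ∧ (L.length : ℤ) ≤ k + 1

/-- A (self-avoiding) path in `T`: a nonempty list of distinct vertices in which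
consecutive vertices are adjacent in `T`. -/
def IsPathT (P : List (ℤ × ℤ)) : Prop :=
  P ≠ [] ∧ P.Nodup ∧ P.Chain' AdjT

/-- An induced path in `T`: a path in which two of its vertices are adjacent in `T`
iff they are consecutive. -/
def IsInducedPathT (P : List (ℤ × ℤ)) : Prop :=
  IsPathT P ∧ ∀ i j : Fin P.length, (i : ℕ) + 1 < (j : ℕ) → ¬ AdjT (P.get i) (P.get j)

/-- The hexagonal norm of `z` is at most `k`. -/
def Hex (z : ℤ × ℤ) (k : ℤ) : Prop :=
  -k ≤ z.1 ∧ z.1 ≤ k ∧ -k ≤ z.2 ∧ z.2 ≤ k ∧ -k ≤ z.1 - z.2 ∧ z.1 - z.2 ≤ k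

/-- The hexagonal sphere of radius `k`. -/
def OnH (z : ℤ × ℤ) (k : ℤ) : Prop := Hex z k ∧ ¬ Hex z (k - 1)

theorem adj_iff (u v : ℤ × ℤ) : AdjT u v ↔ (-1 ≤ u.1 - v.1 ∧ u.1 - v.1 ≤ 1 ∧
    -1 ≤ u.2 - v.2 ∧ u.2 - v.2 ≤ 1 ∧ -1 ≤ (u.1 - u.2) - (v.1 - v.2) ∧
    (u.1 - u.2) - (v.1 - v.2) ≤ 1 ∧ ¬ (u.1 = v.1 ∧ u.2 = v.2)) := by
  obtain ⟨a, b⟩ := u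
  obtain ⟨c, d⟩ := v
  simp only [AdjT, Prod.mk_sub_mk, Set.mem_insert_iff, Set.mem_singleton_iff, Prod.mk.injEq]
  omega

theorem adj_symm {u v : ℤ × ℤ} (h : AdjT u v) : AdjT v u := by
  rw [adj_iff] at *; omega

theorem onH_side {z : ℤ × ℤ} {k : ℤ} (h : OnH z k) :
    (z.1 = k ∧ 0 ≤ z.2 ∧ z.2 ≤ k) ∨ (z.2 = k ∧ 0 ≤ z.1 ∧ z.1 ≤ k) ∨
    (z.2 - z.1 = k ∧ -k ≤ z.1 ∧ z.1 ≤ 0) ∨ (z.1 = -k ∧ -k ≤ z.2 ∧ z.2 ≤ 0) ∨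
    (z.2 = -k ∧ -k ≤ z.1 ∧ z.1 ≤ 0) ∨ (z.1 - z.2 = k ∧ 0 ≤ z.1 ∧ z.1 ≤ k) := by
  simp only [OnH, Hex] at h; omega

/-- Rotation by sixty degrees. -/
def rot (z : ℤ × ℤ) : ℤ × ℤ := (z.1 - z.2, z.1)
/-- The inverse rotation. -/
def tor (z : ℤ × ℤ) : ℤ × ℤ := (z.2, z.2 - z.1)

theorem rot_tor (z : ℤ × ℤ) : rot (tor z) = z := by
  ext <;> simp [rot, tor]
theorem tor_rot (z : ℤ × ℤ) : tor (rot z) = z := by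
  ext <;> simp [rot, tor]
theorem rot_hex (z : ℤ × ℤ) (k : ℤ) : Hex (rot z) k ↔ Hex z k := by
  simp only [Hex, rot]; omega
theorem rot_onH (z : ℤ × ℤ) (k : ℤ) : OnH (rot z) k ↔ OnH z k := by
  simp only [OnH, rot_hex]
theorem rot_adj (z w : ℤ × ℤ) : AdjT (rot z) (rot w) ↔ AdjT z w := by
  simp only [adj_iff, rot]; omega
theorem rot_inj (z w : ℤ × ℤ) : rot z = rot w ↔ z = w := by
  constructor
  · intro h; rw [← tor_rot z, h, tor_rot]
  · rintro rfl; rfl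

theorem rot_wlog (s : ℤ) (hs : 0 < s) (Φ : ℤ × ℤ → Prop) (hrot : ∀ q, Φ (rot q) → Φ q)
    (hbase : ∀ k, 0 ≤ k → k < s → Φ (s, k)) (q : ℤ × ℤ) (hq : OnH q s) : Φ q := by
  have key : ∀ q : ℤ × ℤ, q.1 = s → 0 ≤ q.2 → q.2 < s → Φ q := by
    rintro ⟨a, b⟩ h1 h2 h3
    simp only at h1 h2 h3
    subst h1; exact hbase b h2 h3
  have h := onH_side hq
  by_cases h0 : q.1 = s ∧ 0 ≤ q.2 ∧ q.2 < s
  · exact key _ h0.1 h0.2.1 h0.2.2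
  by_cases h1 : q.1 - q.2 = s ∧ 0 ≤ q.1 ∧ q.1 < s
  · apply hrot; apply key <;> simp only [rot] <;> omega
  by_cases h2 : q.2 = -s ∧ q.1 < 0
  · apply hrot; apply hrot; apply key <;> simp only [rot] <;> omega
  by_cases h3 : q.1 = -s ∧ q.2 ≤ 0
  · apply hrot; apply hrot; apply hrot; apply key <;> simp only [rot] <;> omega
  by_cases h4 : q.2 - q.1 = s ∧ q.1 ≤ 0
  · apply hrot; apply hrot; apply hrot; apply hrot; apply key <;> simp only [rot] <;> omega
  · apply hrot; apply hrot; apply hrot; apply hrot; apply hrot; apply key <;>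
      simp only [rot] <;> omega

set_option maxHeartbeats 1000000 in
theorem lemA_base (r k : ℤ) (hr : 5 ≤ r) (hk : 0 ≤ k) (hkr : k < r) (u : ℤ × ℤ) (hu : OnH u r)
    (hne : u ≠ (r, k)) (hadj : ¬ AdjT u (r, k)) :
    ∃ u' v', OnH u' (r - 1) ∧ OnH v' (r - 1) ∧ AdjT u u' ∧ AdjT (r, k) v' ∧ ¬ AdjT u' v' ∧
      u' ≠ v' ∧ ¬ AdjT u v' := by
  obtain ⟨x, y⟩ := u
  have hs := onH_side hu
  simp only [adj_iff, ne_eq, Prod.mk.injEq] at *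
  have hv : ∃ p, 0 ≤ p ∧ p < r ∧ (p = k ∨ p = k - 1) ∧
     ((k = 0 ∧ p = k) ∨ (0 < k ∧ ((x = r ∧ k + 2 ≤ y) ∨ (y = r ∧ 0 ≤ x)) ∧ p = k - 1) ∨
      (0 < k ∧ ¬ ((x = r ∧ k + 2 ≤ y) ∨ (y = r ∧ 0 ≤ x)) ∧ p = k)) := by
    by_cases h0 : k = 0
    · exact ⟨k, by omega⟩
    by_cases h1 : (x = r ∧ k + 2 ≤ y) ∨ (y = r ∧ 0 ≤ x)
    · exact ⟨k - 1, by omega⟩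
    · exact ⟨k, by omega⟩
  obtain ⟨p, hp0, hp1, hp2, hp⟩ := hv
  have hu' : ∃ x' y' : ℤ, OnH (x', y') (r - 1) ∧ (-1 ≤ x - x' ∧ x - x' ≤ 1 ∧
      -1 ≤ y - y' ∧ y - y' ≤ 1 ∧ -1 ≤ (x - y) - (x' - y') ∧
    (x - y) - (x' - y') ≤ 1) ∧ (x' < r - 3 ∨ y' < p - 1 ∨ p + 1 < y' ∨ x' - y' < r - 1 - p - 1
      ∨ r - 1 - p + 1 < x' - y') := by
    simp only [OnH, Hex]
    rcases hs with hs | hs | hs | hs | hs | hs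
    · by_cases hy : y = r
      · exact ⟨r - 1, r - 1, by omega⟩
      by_cases hy0 : y = 0
      · exact ⟨r - 1, 0, by omega⟩
      by_cases hk0 : k = 0
      · exact ⟨r - 1, y, by omega⟩
      · exact ⟨r - 1, y - 1, by omega⟩
    · by_cases hx : x = 0
      · exact ⟨0, r - 1, by omega⟩
      · exact ⟨x - 1, r - 1, by omega⟩
    · by_cases hx : x = 0
      · exact ⟨0, r - 1, by omega⟩
      · exact ⟨x + 1, y, by omega⟩
    · by_cases hx : y = 0
      · exact ⟨x + 1, 0, by omega⟩
      · exact ⟨x + 1, y + 1, by omega⟩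
    · by_cases hx : x = 0
      · exact ⟨0, y + 1, by omega⟩
      · exact ⟨x + 1, y + 1, by omega⟩
    · by_cases hx : x = 0
      · exact ⟨0, y + 1, by omega⟩
      · exact ⟨x - 1, y, by omega⟩
  obtain ⟨x', y', h1, h2, h3⟩ := hu'
  have h4 : ¬ (x = x' ∧ y = y') := by
    rintro ⟨rfl, rfl⟩
    exact hu.2 h1.1
  refine ⟨(x', y'), (r - 1, p), h1, ?_⟩
  clear h1 hu
  simp only [OnH, Hex]
  simp only [Prod.mk.injEq]
  refine ⟨by clear h2 h3 h4 hs hp; omega, by clear hs hp; omega, by clear h2 h3 h4 hs hp; omega,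
    by clear hs hp h2; omega, by clear hs hp h2; omega, ?_⟩
  clear h2 h3 h4
  rintro ⟨a1, a2, a3, a4, a5, a6, a7⟩
  rcases hs with hs | hs | hs | hs | hs | hs <;> omega

theorem lemA (r : ℤ) (hr : 5 ≤ r) (v : ℤ × ℤ) (hv : OnH v r) : ∀ u, OnH u r →
    u ≠ v → ¬ AdjT u v →
    ∃ u' v', OnH u' (r - 1) ∧ OnH v' (r - 1) ∧ AdjT u u' ∧ AdjT v v' ∧ ¬ AdjT u' v' ∧
      u' ≠ v' ∧ ¬ AdjT u v' := by
  revert v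
  apply rot_wlog r (by omega)
  · intro q h u hu hne hadj
    obtain ⟨u', v', h1, h2, h3, h4, h5, h6, h7⟩ := h (rot u) ((rot_onH _ _).2 hu)
      (by rwa [ne_eq, rot_inj]) (by rwa [rot_adj])
    rw [← rot_tor u', ← rot_tor v'] at *
    simp only [rot_onH, rot_adj, ne_eq, rot_inj] at *
    exact ⟨_, _, h1, h2, h3, h4, h5, h6, h7⟩
  · intro k hk hkr u hu hne hadj
    exact lemA_base r k hr hk hkr u hu hne hadj

theorem lemC (s : ℤ) (hs : 3 ≤ s) (q : ℤ × ℤ) (hq : OnH q s) : ∃ w, OnH w (s - 1) ∧ AdjT q w ∧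
    ∀ z, OnH z s → AdjT z w → z = q ∨ AdjT z q := by
  revert q
  apply rot_wlog s (by omega)
  · rintro q ⟨w, h1, h2, h3⟩
    rw [← rot_tor w] at *
    simp only [rot_onH, rot_adj] at *
    refine ⟨_, h1, h2, fun z hz hzw => ?_⟩
    have := h3 (rot z) ((rot_onH _ _).2 hz) ((rot_adj _ _).2 hzw)
    simpa only [rot_inj, rot_adj] using this
  · intro k hk hkr
    by_cases h0 : k = 0
    · refine ⟨(s - 1, 0), ?_⟩
      simp only [OnH, Hex, adj_iff, Prod.ext_iff]
      exact ⟨by omega, by omega, fun z => by omega⟩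
    by_cases h1 : k = 1
    · refine ⟨(s - 1, 1), ?_⟩
      simp only [OnH, Hex, adj_iff, Prod.ext_iff]
      exact ⟨by omega, by omega, fun z => by omega⟩
    · refine ⟨(s - 1, k - 1), ?_⟩
      simp only [OnH, Hex, adj_iff, Prod.ext_iff]
      exact ⟨by omega, by omega, fun z => by omega⟩

theorem lemD (s : ℤ) (hs : 1 ≤ s) (q : ℤ × ℤ) (hq : OnH q s) :
    ∃ w, OnH w (s - 1) ∧ AdjT q w := by
  revert q
  apply rot_wlog s (by omega)
  · rintro q ⟨w, h1, h2⟩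
    rw [← rot_tor w] at *
    simp only [rot_onH, rot_adj] at *
    exact ⟨_, h1, h2⟩
  · intro k hk hkr
    refine ⟨(s - 1, k), ?_⟩
    simp only [OnH, Hex, adj_iff]
    exact ⟨by omega, by omega⟩

theorem lemE (s : ℤ) (hs : 1 ≤ s) (v : ℤ × ℤ) (hv : OnH v s) : ∀ z q, OnH z (s - 1) → OnH q (s - 1) →
    AdjT z v → AdjT q v → z = q ∨ AdjT z q := by
  revert v
  apply rot_wlog s (by omega)
  · intro v h z q hz hq h1 h2
    have := h (rot z) (rot q) ((rot_onH _ _).2 hz) ((rot_onH _ _).2 hq) ((rot_adj _ _).2 h1)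
      ((rot_adj _ _).2 h2)
    simpa only [rot_inj, rot_adj] using this
  · rintro k hk hkr ⟨a, b⟩ ⟨c, d⟩
    simp only [OnH, Hex, adj_iff, Prod.mk.injEq]
    intro h1 h2 h3 h4
    have : a = s - 1 := by omega
    have : c = s - 1 := by omega
    omega

/-- The graph induced by `T` on `S`. -/
def GT (S : Set (ℤ × ℤ)) : SimpleGraph (ℤ × ℤ) where
  Adj x y := x ∈ S ∧ y ∈ S ∧ AdjT x y
  symm := ⟨fun _ _ h => ⟨h.2.1, h.1, adj_symm h.2.2⟩⟩
  loopless := ⟨fun x h => by have := h.2.2; rw [adj_iff] at this; omega⟩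

theorem GT_mono {S S' : Set (ℤ × ℤ)} (h : S ⊆ S') {x y : ℤ × ℤ} (hr : (GT S).Reachable x y) :
    (GT S').Reachable x y :=
  SimpleGraph.Reachable.mono (G := GT S) (G' := GT S')
    (fun a b (hh : a ∈ S ∧ b ∈ S ∧ AdjT a b) => ⟨h hh.1, h hh.2.1, hh.2.2⟩) hr

theorem GT_adj {S : Set (ℤ × ℤ)} {x y : ℤ × ℤ} (hx : x ∈ S) (hy : y ∈ S) (h : AdjT x y) :
    (GT S).Reachable x y :=
  SimpleGraph.Adj.reachable (G := GT S) ⟨hx, hy, h⟩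

theorem reach_descent (W : Set (ℤ × ℤ)) (b : ℤ × ℤ) (μ : ℤ × ℤ → ℤ) (h0 : ∀ z ∈ W, 0 ≤ μ z)
    (hstep : ∀ z ∈ W, z ≠ b → ∃ z' ∈ W, AdjT z z' ∧ μ z' < μ z) :
    ∀ z ∈ W, (GT W).Reachable z b := by
  have : ∀ n : ℕ, ∀ z ∈ W, μ z ≤ n → (GT W).Reachable z b := by
    intro n
    induction n with
    | zero =>
      intro z hz hn
      by_cases hb : z = b
      · subst hb; exact SimpleGraph.Reachable.refl _
      · obtain ⟨z', hz', _, hlt⟩ := hstep z hz hb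
        have := h0 z' hz'
        push_cast at hn; omega
    | succ n ih =>
      intro z hz hn
      by_cases hb : z = b
      · subst hb; exact SimpleGraph.Reachable.refl _
      · obtain ⟨z', hz', ha, hlt⟩ := hstep z hz hb
        push_cast at hn
        exact (GT_adj hz hz' ha).trans (ih z' hz' (by omega))
  intro z hz
  exact this (μ z).toNat z hz (by have := h0 z hz; omega)

/-- The ring of radius `s` with the closed neighbourhood of `q` removed. -/
def RingT (s : ℤ) (q : ℤ × ℤ) : Set (ℤ × ℤ) := {z | OnH z s ∧ z ≠ q ∧ ¬ AdjT z q}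

theorem rot_ring (s : ℤ) (q z : ℤ × ℤ) : rot z ∈ RingT s (rot q) ↔ z ∈ RingT s q := by
  simp only [RingT, Set.mem_ofPred_eq, rot_onH, rot_adj, ne_eq, rot_inj]

set_option maxHeartbeats 4000000 in
theorem ring_base (s k : ℤ) (hs : 4 ≤ s) (hk : 0 ≤ k) (hks : k < s) :
    ∀ z ∈ RingT s (s, k), (GT (RingT s (s, k))).Reachable z (0, -s) := by
  apply reach_descent _ _ (fun z => if z.1 ≤ 0 ∨ 2 * z.2 - z.1 < 2 * k - s then
    2 * z.2 - z.1 + 2 * s else 8 * s - (2 * z.2 - z.1))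
  · rintro ⟨x, y⟩ ⟨⟨h1, _⟩, _⟩
    simp only [Hex] at h1 ⊢
    split_ifs <;> omega
  · rintro ⟨x, y⟩ ⟨h1, h2, h3⟩ h4
    have hside := onH_side h1
    clear h1
    simp only [RingT, Set.mem_ofPred_eq, OnH, Hex, adj_iff, ne_eq, Prod.mk.injEq] at *
    by_cases hx : x ≤ 0
    · by_cases a1 : y - x = s ∧ -s < x
      · refine ⟨(x - 1, y - 1), ?_⟩
        simp only [Prod.mk.injEq]
        rw [if_pos (by omega), if_pos (by omega)]
        refine ⟨⟨by omega, by omega, by omega⟩, by omega, by omega⟩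
      by_cases a2 : x = -s ∧ -s < y
      · refine ⟨(x, y - 1), ?_⟩
        simp only [Prod.mk.injEq]
        rw [if_pos (by omega), if_pos (by omega)]
        refine ⟨⟨by omega, by omega, by omega⟩, by omega, by omega⟩
      · have : y = -s ∧ x < 0 := by omega
        refine ⟨(x + 1, y), ?_⟩
        simp only [Prod.mk.injEq]
        rw [if_pos (by omega), if_pos (by omega)]
        refine ⟨⟨by omega, by omega, by omega⟩, by omega, by omega⟩
    · by_cases hf : 2 * y - x < 2 * k - s
      · by_cases a1 : x = s ∧ 0 < y
        · refine ⟨(x, y - 1), ?_⟩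
          simp only [Prod.mk.injEq]
          rw [if_pos (by omega), if_pos (by omega)]
          refine ⟨⟨by omega, by omega, by omega⟩, by omega, by omega⟩
        · have : x - y = s := by omega
          refine ⟨(x - 1, y - 1), ?_⟩
          simp only [Prod.mk.injEq]
          rw [if_pos (by omega), if_pos (by omega)]
          refine ⟨⟨by omega, by omega, by omega⟩, by omega, by omega⟩
      · by_cases a1 : x = s ∧ y < s
        · refine ⟨(x, y + 1), ?_⟩
          simp only [Prod.mk.injEq]
          rw [if_neg (by omega), if_neg (by omega)]
          refine ⟨⟨by omega, by omega, by omega⟩, by omega, by omega⟩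
        · have : y = s := by omega
          refine ⟨(x - 1, y), ?_⟩
          simp only [Prod.mk.injEq]
          rw [if_neg (by omega : ¬ (x ≤ 0 ∨ 2 * y - x < 2 * k - s))]
          refine ⟨⟨by omega, by omega, by omega⟩, by omega, ?_⟩
          split_ifs <;> omega

theorem rot_reach (s : ℤ) (q : ℤ × ℤ) {z w : ℤ × ℤ}
    (h : (GT (RingT s (rot q))).Reachable z w) : (GT (RingT s q)).Reachable (tor z) (tor w) := by
  let f : GT (RingT s (rot q)) →g GT (RingT s q) :=
    ⟨tor, fun {a b} hab => by
      rw [← rot_tor a, ← rot_tor b] at hab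
      refine ⟨(rot_ring _ _ _).1 hab.1, (rot_ring _ _ _).1 hab.2.1, (rot_adj _ _).1 hab.2.2⟩⟩
  exact h.map f

theorem lemB (s : ℤ) (hs : 4 ≤ s) (q : ℤ × ℤ) (hq : OnH q s) :
    ∀ z ∈ RingT s q, ∀ w ∈ RingT s q, (GT (RingT s q)).Reachable z w := by
  revert q
  apply rot_wlog s (by omega)
  · intro q h z hz w hw
    have := rot_reach s q (h (rot z) ((rot_ring _ _ _).2 hz) (rot w) ((rot_ring _ _ _).2 hw))
    rwa [tor_rot, tor_rot] at this
  · intro k hk hks z hz w hw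
    exact (ring_base s k hs hk hks z hz).trans (ring_base s k hs hk hks w hw).symm

/-- Two arms joining `u` and `v` to the two neighbours of the origin on the axis. -/
def Good (m r : ℤ) (u v : ℤ × ℤ) : Prop :=
  ∃ U V : Set (ℤ × ℤ), u ∈ U ∧ v ∈ V ∧
    (∀ z ∈ U, Hex z r ∧ z ≠ 0 ∧ (¬ Hex z (r - 1) → z = u) ∧ (Hex z m → z.2 = 0)) ∧
    (∀ z ∈ V, Hex z r ∧ z ≠ 0 ∧ (¬ Hex z (r - 1) → z = v) ∧ (Hex z m → z.2 = 0)) ∧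
    (∀ z ∈ U, ∀ w ∈ V, ¬ AdjT z w) ∧
    (∀ i : ℤ, -m ≤ i → i ≤ m → i ≠ 0 → (i, 0) ∈ U ∪ V) ∧
    (∃ e ∈ U, AdjT e 0 ∧ (GT U).Reachable u e) ∧
    (∃ e ∈ V, AdjT e 0 ∧ (GT V).Reachable v e)

theorem neg_adj (z w : ℤ × ℤ) : AdjT (-z) (-w) ↔ AdjT z w := by
  simp only [adj_iff, Prod.fst_neg, Prod.snd_neg]; omega
theorem neg_hex (z : ℤ × ℤ) (k : ℤ) : Hex (-z) k ↔ Hex z k := by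
  simp only [Hex, Prod.fst_neg, Prod.snd_neg]; omega

theorem neg_reach (U : Set (ℤ × ℤ)) {z w : ℤ × ℤ} (h : (GT U).Reachable z w) :
    (GT {x | -x ∈ U}).Reachable (-z) (-w) := by
  let f : GT U →g GT {x | -x ∈ U} :=
    ⟨fun x => -x, fun {a b} hab => by
      refine ⟨?_, ?_, (neg_adj _ _).2 hab.2.2⟩
      · simpa using hab.1
      · simpa using hab.2.1⟩
  exact h.map f

theorem good_neg (m r : ℤ) (u v : ℤ × ℤ) (h : Good m r (-u) (-v)) : Good m r u v := by
  obtain ⟨U, V, hu, hv, hU, hV, hUV, hi, ⟨e, he, he0, her⟩, ⟨f, hf, hf0, hfr⟩⟩ := h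
  refine ⟨{x | -x ∈ U}, {x | -x ∈ V}, hu, hv, ?_, ?_, ?_, ?_, ⟨-e, by simpa using he, ?_, ?_⟩,
    ⟨-f, by simpa using hf, ?_, ?_⟩⟩
  · intro z hz
    simpa only [neg_hex, ne_eq, neg_eq_zero, neg_inj, Prod.snd_neg] using hU (-z) hz
  · intro z hz
    simpa only [neg_hex, ne_eq, neg_eq_zero, neg_inj, Prod.snd_neg] using hV (-z) hz
  · intro z hz w hw
    simpa only [neg_adj] using hUV (-z) hz (-w) hw
  · intro i h1 h2 h3
    simpa using hi (-i) (by omega) (by omega) (by omega)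
  · rw [← neg_adj]; simpa using he0
  · simpa using neg_reach U her
  · rw [← neg_adj]; simpa using hf0
  · simpa using neg_reach V hfr

theorem pos_axis (U : Set (ℤ × ℤ)) (n : ℕ) (h : ∀ i : ℤ, 1 ≤ i → i ≤ n + 1 → (i, 0) ∈ U) :
    (GT U).Reachable ((n : ℤ) + 1, 0) (1, 0) := by
  induction n with
  | zero => exact SimpleGraph.Reachable.refl _
  | succ n ih =>
    have a1 := h (((n + 1 : ℕ) : ℤ) + 1) (by omega) (by omega)
    have a2 := h ((n : ℤ) + 1) (by omega) (by push_cast; omega)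
    refine SimpleGraph.Reachable.trans (GT_adj a1 a2 ?_)
      (ih fun i h1 h2 => h i h1 (by push_cast; omega))
    rw [adj_iff]; simp only; omega

theorem neg_axis (U : Set (ℤ × ℤ)) (n : ℕ) (h : ∀ i : ℤ, 1 ≤ i → i ≤ n + 1 → (-i, 0) ∈ U) :
    (GT U).Reachable (-((n : ℤ) + 1), 0) (-1, 0) := by
  induction n with
  | zero => exact SimpleGraph.Reachable.refl _
  | succ n ih =>
    have a1 := h (((n + 1 : ℕ) : ℤ) + 1) (by omega) (by omega)
    have a2 := h ((n : ℤ) + 1) (by omega) (by push_cast; omega)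
    refine SimpleGraph.Reachable.trans (GT_adj a1 a2 ?_)
      (ih fun i h1 h2 => h i h1 (by push_cast; omega))
    rw [adj_iff]; simp only; omega

theorem hex_mono {z : ℤ × ℤ} {a b : ℤ} (h : Hex z a) (hab : a ≤ b) : Hex z b := by
  simp only [Hex] at *; omega

theorem onH_not_adj {z w : ℤ × ℤ} {a b : ℤ} (hz : OnH z a) (hw : Hex w b) (hab : b + 1 < a) :
    ¬ AdjT z w := by
  intro h
  apply hz.2
  rw [adj_iff] at h
  clear hz
  simp only [Hex] at *; omega

set_option maxHeartbeats 2000000 in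
theorem good_core (m : ℤ) (hm : 0 < m) (u v u' v' : ℤ × ℤ)
    (hu : OnH u (m + 10)) (hv : OnH v (m + 10)) (huv : ¬ AdjT u v)
    (hu' : OnH u' (m + 9)) (hv' : OnH v' (m + 9)) (huu : AdjT u u') (hvv : AdjT v v')
    (hadj : ¬ AdjT u' v') (hne : u' ≠ v') (huv' : ¬ AdjT u v') (hx : v'.1 ≤ 0) :
    Good m (m + 10) u v := by
  obtain ⟨w, hw, hvw, hwall⟩ := lemC (m + 9) (by omega) v' hv'
  obtain ⟨w', hw', hww⟩ := lemD (m + 9 - 1) (by omega) w hw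
  rw [show m + 9 - 1 - 1 = m + 7 by ring] at hw'
  rw [show m + 9 - 1 = m + 8 by ring] at hw
  have hE := lemE (m + 10) (by omega) v hv
  rw [show m + 10 - 1 = m + 9 by ring] at hE
  have hcorner : ((m + 9, 0) : ℤ × ℤ) ∈ RingT (m + 9) v' := by
    clear hE hwall
    refine ⟨?_, ?_, ?_⟩
    · simp only [OnH, Hex]; omega
    · rintro rfl; simp only at hx; omega
    · rw [adj_iff]; simp only; omega
  have hvx : v.1 ≤ 1 := by rw [adj_iff] at hvv; omega
  have hwx : w.1 ≤ 1 := by rw [adj_iff] at hvw; omega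
  have hwx' : w'.1 ≤ 2 := by rw [adj_iff] at hww; omega
  have hu'R : u' ∈ RingT (m + 9) v' := ⟨hu', hne, hadj⟩
  have hw'R : w' ∈ RingT (m + 7) (m + 7, 0) := by
    refine ⟨hw', ?_, ?_⟩
    · rintro rfl; simp only at hwx'; omega
    · rw [adj_iff]; simp only; omega
  have hcR : ((-(m + 7), 0) : ℤ × ℤ) ∈ RingT (m + 7) (m + 7, 0) := by
    refine ⟨?_, ?_, ?_⟩
    · simp only [OnH, Hex]; omega
    · rw [ne_eq, Prod.mk.injEq]; omega
    · rw [adj_iff]; simp only; omega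
  have hq7 : OnH ((m + 7, 0) : ℤ × ℤ) (m + 7) := by
    simp only [OnH, Hex]; omega
  let A : Set (ℤ × ℤ) := {z | ∃ i : ℤ, 1 ≤ i ∧ i ≤ m + 9 ∧ z = (i, 0)}
  let B : Set (ℤ × ℤ) := {z | ∃ i : ℤ, 1 ≤ i ∧ i ≤ m + 7 ∧ z = (-i, 0)}
  let U : Set (ℤ × ℤ) := {u} ∪ RingT (m + 9) v' ∪ A
  let V : Set (ℤ × ℤ) := {v, v', w} ∪ RingT (m + 7) (m + 7, 0) ∪ B
  have hRU : RingT (m + 9) v' ⊆ U := fun z hz => Or.inl (Or.inr hz)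
  have hRV : RingT (m + 7) (m + 7, 0) ⊆ V := fun z hz => Or.inl (Or.inr hz)
  have hAU : A ⊆ U := fun z hz => Or.inr hz
  have hBV : B ⊆ V := fun z hz => Or.inr hz
  have huU : u ∈ U := by simp [U]
  have hvV : v ∈ V := by simp [V]
  have hv'V : v' ∈ V := by simp [V]
  have hwV : w ∈ V := by simp [V]
  -- membership facts for single points on spheres
  have sph : ∀ z : ℤ × ℤ, ∀ k : ℤ, m < k → k ≤ m + 9 → OnH z k → ∀ p : ℤ × ℤ,
      Hex z (m + 10) ∧ z ≠ 0 ∧ (¬ Hex z (m + 10 - 1) → z = p) ∧ (Hex z m → z.2 = 0) := by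
    intro z k h1 h2 h3 p
    refine ⟨hex_mono h3.1 (by omega), ?_, fun h => absurd (hex_mono h3.1 (by omega)) h,
      fun h => absurd (hex_mono h (by omega)) h3.2⟩
    rintro rfl
    apply h3.2
    simp only [Hex, Prod.fst_zero, Prod.snd_zero]; omega
  have sph10 : ∀ z : ℤ × ℤ, OnH z (m + 10) →
      Hex z (m + 10) ∧ z ≠ 0 ∧ (¬ Hex z (m + 10 - 1) → z = z) ∧ (Hex z m → z.2 = 0) := by
    intro z h3
    refine ⟨h3.1, ?_, fun _ => rfl, fun h => absurd (hex_mono h (by omega)) h3.2⟩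
    rintro rfl
    apply h3.2
    simp only [Hex, Prod.fst_zero, Prod.snd_zero]; omega
  have hA : ∀ z ∈ A, z.2 = 0 ∧ 1 ≤ z.1 ∧ z.1 ≤ m + 9 := by
    rintro z ⟨i, h1, h2, rfl⟩; exact ⟨rfl, h1, h2⟩
  have hB : ∀ z ∈ B, z.2 = 0 ∧ z.1 ≤ -1 ∧ -(m + 7) ≤ z.1 := by
    rintro z ⟨i, h1, h2, rfl⟩; exact ⟨rfl, by simp only; omega, by simp only; omega⟩
  have axis : ∀ z : ℤ × ℤ, z.2 = 0 → z.1 ≠ 0 → -(m + 9) ≤ z.1 → z.1 ≤ m + 9 → ∀ p : ℤ × ℤ,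
      Hex z (m + 10) ∧ z ≠ 0 ∧ (¬ Hex z (m + 10 - 1) → z = p) ∧ (Hex z m → z.2 = 0) := by
    intro z h1 h2 h3 h4 p
    refine ⟨by simp only [Hex]; omega, ?_, fun h => absurd (by simp only [Hex]; omega) h,
      fun _ => h1⟩
    rintro rfl; exact h2 rfl
  have hring : ∀ z ∈ RingT (m + 9) v', ∀ y ∈ V, ¬ AdjT z y := by
    intro z hz y hy
    rcases hy with ((rfl | rfl | rfl) | hy) | hy
    · intro h
      rcases hE z v' hz.1 hv' h (adj_symm hvv) with h1 | h1
      · exact hz.2.1 h1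
      · exact hz.2.2 h1
    · exact hz.2.2
    · intro h
      rcases hwall z hz.1 h with h1 | h1
      · exact hz.2.1 h1
      · exact hz.2.2 h1
    · exact onH_not_adj hz.1 hy.1.1 (by omega)
    · have := hB y hy
      exact onH_not_adj (b := m + 7) hz.1 (by simp only [Hex]; omega) (by omega)
  refine ⟨U, V, huU, hvV, ?_, ?_, ?_, ?_, ?_, ?_⟩
  · rintro z ((rfl | hz) | hz)
    · exact sph10 _ hu
    · exact sph z _ (by omega) (by omega) hz.1 _
    · have := hA z hz
      exact axis z this.1 (by omega) (by omega) (by omega) _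
  · rintro z (((rfl | rfl | rfl) | hz) | hz)
    · exact sph10 _ hv
    · exact sph _ _ (by omega) (by omega) hv' _
    · exact sph _ _ (by omega) (by omega) hw _
    · exact sph z _ (by omega) (by omega) hz.1 _
    · have := hB z hz
      exact axis z this.1 (by omega) (by omega) (by omega) _
  · rintro z ((rfl | hz) | hz) y hy
    · rcases hy with ((rfl | rfl | rfl) | hy) | hy
      · exact huv
      · exact huv'
      · exact onH_not_adj hu hw.1 (by omega)
      · exact onH_not_adj hu hy.1.1 (by omega)
      · have := hB y hy
        exact onH_not_adj (b := m + 7) hu (by simp only [Hex]; omega) (by omega)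
    · exact hring z hz y hy
    · have hz' := hA z hz
      by_cases hz9 : z.1 = m + 9
      · have : z = (m + 9, 0) := Prod.ext hz9 hz'.1
        rw [this]
        exact hring _ hcorner y hy
      have hzh : Hex z z.1 := by simp only [Hex]; omega
      rcases hy with ((rfl | rfl | rfl) | hy) | hy
      · intro h; exact onH_not_adj hv hzh (by omega) (adj_symm h)
      · by_cases h8 : z.1 < m + 8
        · intro h; exact onH_not_adj hv' hzh (by omega) (adj_symm h)
        · rw [adj_iff]; omega
      · by_cases h8 : z.1 < m + 7
        · intro h; exact onH_not_adj hw hzh (by omega) (adj_symm h)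
        · rw [adj_iff]; omega
      · obtain ⟨h1, h2, h3⟩ := hy
        have h1' := onH_side h1
        clear h1
        intro h
        rw [adj_iff] at h h3
        rw [ne_eq, Prod.ext_iff] at h2
        simp only at h2 h3
        omega
      · have := hB y hy
        rw [adj_iff]; omega
  · intro i h1 h2 h3
    by_cases h : 0 < i
    · exact Or.inl (hAU ⟨i, by omega, by omega, rfl⟩)
    · exact Or.inr (hBV ⟨-i, by omega, by omega, by simp⟩)
  · refine ⟨(1, 0), hAU ⟨1, by omega, by omega, rfl⟩, by rw [adj_iff]; simp, ?_⟩
    refine (GT_adj huU (hRU hu'R) huu).trans ?_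
    refine (GT_mono hRU (lemB (m + 9) (by omega) v' hv' u' hu'R _ hcorner)).trans ?_
    have := pos_axis U (m + 8).toNat (fun i h1 h2 => hAU ⟨i, h1, by omega, rfl⟩)
    rwa [Int.toNat_of_nonneg (by omega), show m + 8 + 1 = m + 9 by ring] at this
  · refine ⟨(-1, 0), hBV ⟨1, by omega, by omega, rfl⟩, by rw [adj_iff]; simp, ?_⟩
    refine (GT_adj hvV hv'V hvv).trans ?_
    refine (GT_adj hv'V hwV hvw).trans ?_
    refine (GT_adj hwV (hRV hw'R) hww).trans ?_
    refine (GT_mono hRV (lemB (m + 7) (by omega) _ hq7 w' hw'R _ hcR)).trans ?_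
    have := neg_axis V (m + 6).toNat (fun i h1 h2 => hBV ⟨i, h1, by omega, rfl⟩)
    rwa [Int.toNat_of_nonneg (by omega), show m + 6 + 1 = m + 7 by ring] at this

theorem neg_onH (z : ℤ × ℤ) (k : ℤ) : OnH (-z) k ↔ OnH z k := by
  simp only [OnH, neg_hex]

theorem geom (m : ℤ) (hm : 0 < m) (u v : ℤ × ℤ) (hu : OnH u (m + 10)) (hv : OnH v (m + 10))
    (hne : u ≠ v) (huv : ¬ AdjT u v) : Good m (m + 10) u v := by
  obtain ⟨u', v', h1, h2, h3, h4, h5, h6, h7⟩ := lemA (m + 10) (by omega) v hv u hu hne huv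
  rw [show m + 10 - 1 = m + 9 by ring] at h1 h2
  by_cases hx : v'.1 ≤ 0
  · exact good_core m hm u v u' v' hu hv huv h1 h2 h3 h4 h5 h6 h7 hx
  · apply good_neg
    refine good_core m hm (-u) (-v) (-u') (-v') ?_ ?_ ?_ ?_ ?_ ?_ ?_ ?_ ?_ ?_ ?_ <;>
      simp only [neg_onH, neg_adj, ne_eq, neg_inj, Prod.fst_neg, *] <;>
      first | omega | trivial

theorem hex_adj {z w : ℤ × ℤ} {k : ℤ} (h : AdjT z w) (hw : Hex w k) : Hex z (k + 1) := by
  rw [adj_iff] at h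
  simp only [Hex] at *; omega

theorem ball_to_hex (L : List (ℤ × ℤ)) : ∀ (h : L ≠ []), L.IsChain AdjT → L.getLast h = 0 →
    Hex (L.head h) (L.length - 1) := by
  induction L with
  | nil => intro h; exact absurd rfl h
  | cons a t ih =>
    intro h hc hl
    cases t with
    | nil =>
      simp only [List.getLast_singleton] at hl
      subst hl
      simp [Hex]
    | cons b t =>
      rw [List.isChain_cons_cons] at hc
      have := ih (by simp) hc.2 (by simpa using hl)
      simp only [List.head_cons, List.length_cons] at this ⊢
      have := hex_adj hc.1 this
      push_cast at this ⊢
      convert this using 1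
      ring

theorem hex_to_ball (n : ℕ) : ∀ z : ℤ × ℤ, Hex z n → InBallT z n := by
  induction n with
  | zero =>
    intro z hz
    have : z = 0 := by
      simp only [Hex] at hz
      ext <;> simp only [Prod.fst_zero, Prod.snd_zero] <;> push_cast at hz <;> omega
    subst this
    exact ⟨[0], by simp, by exact List.IsChain.singleton _, by simp, by simp, by simp⟩
  | succ n ih =>
    intro z hz
    by_cases h : Hex z n
    · obtain ⟨L, h1, h2, h3, h4, h5⟩ := ih z h
      exact ⟨L, h1, h2, h3, h4, by push_cast; omega⟩
    · obtain ⟨w, hw, hzw⟩ := lemD (n + 1) (by omega) z ⟨by exact_mod_cast hz, by simpa using h⟩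
      rw [add_sub_cancel_right] at hw
      obtain ⟨L, h1, h2, h3, h4, h5⟩ := ih w hw.1
      refine ⟨z :: L, by simp, ?_, by simp, ?_, by simp; omega⟩
      · change List.IsChain _ _
        cases L with
        | nil => exact absurd rfl h1
        | cons b t =>
          rw [List.isChain_cons_cons]
          simp only [List.head_cons] at h3
          subst h3
          exact ⟨hzw, h2⟩
      · rw [List.getLast_cons h1]; exact h4

theorem ball_iff (z : ℤ × ℤ) (k : ℤ) (hk : 0 ≤ k) : InBallT z k ↔ Hex z k := by
  constructor
  · rintro ⟨L, h, hc, rfl, hl, hlen⟩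
    exact hex_mono (ball_to_hex L h hc hl) (by omega)
  · intro h
    have := hex_to_ball k.toNat z (by rwa [Int.toNat_of_nonneg hk])
    rwa [Int.toNat_of_nonneg hk] at this

theorem chain_closed (A : ℤ × ℤ → Prop) (S : Set (ℤ × ℤ))
    (hcl : ∀ x y, A x → y ∈ S → y ≠ 0 → AdjT x y → A y) (L : List (ℤ × ℤ)) :
    ∀ (h : L ≠ []), L.IsChain AdjT → (∀ x ∈ L, x ∈ S) → (0 : ℤ × ℤ) ∉ L → A (L.head h) →
      A (L.getLast h) := by
  induction L with
  | nil => intro h; exact absurd rfl h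
  | cons a t ih =>
    intro h hc hS h0 hA
    cases t with
    | nil => simpa using hA
    | cons b t =>
      rw [List.isChain_cons_cons] at hc
      rw [List.getLast_cons (by simp)]
      apply ih (by simp) hc.2 (fun x hx => hS x (by simp_all)) (fun hx => h0 (by simp_all))
      simp only [List.head_cons] at hA ⊢
      exact hcl a b hA (hS b (by simp)) (fun hb => h0 (by simp [hb])) hc.1

theorem statement9 (m : ℤ) (hm : 0 < m) :
    ∃ r : ℤ, m < r ∧
      ∀ (P : List (ℤ × ℤ)) (hne : P ≠ []),
        IsInducedPathT P → (0 : ℤ × ℤ) ∈ P →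
        ¬ InBallT (P.head hne) (r + 2) → ¬ InBallT (P.getLast hne) (r + 2) →
        ∃ S : Set (ℤ × ℤ),
          (∀ x : ℤ × ℤ, ¬ InBallT x r → (x ∈ S ↔ x ∈ P)) ∧
          ({x : ℤ × ℤ | x ∈ S ∧ InBallT x m} =
            {x : ℤ × ℤ | ∃ i : ℤ, -m ≤ i ∧ i ≤ m ∧ x = (i, 0)}) ∧
          (∃ (L : List (ℤ × ℤ)) (h : L ≠ []),
            L.Nodup ∧ L.Chain' AdjT ∧ (∀ x ∈ L, x ∈ S) ∧
            L.head h = P.head hne ∧ L.getLast h = P.getLast hne) ∧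
          (∀ (L : List (ℤ × ℤ)) (h : L ≠ []),
            L.Nodup → L.Chain' AdjT → (∀ x ∈ L, x ∈ S) →
            L.head h = P.head hne → L.getLast h = P.getLast hne →
            (0 : ℤ × ℤ) ∈ L) := by
  classical
  refine ⟨m + 10, by omega, ?_⟩
  intro P hne hP h0 ha hb
  obtain ⟨⟨_, hnd, hch⟩, hind⟩ := hP
  have hch' : P.IsChain AdjT := hch
  rw [List.isChain_iff_getElem] at hch'
  rw [ball_iff _ _ (by omega)] at ha hb
  have hinj : ∀ i j (hi : i < P.length) (hj : j < P.length), P[i] = P[j] → i = j := by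
    intro i j hi hj h
    exact (List.Nodup.getElem_inj_iff hnd).1 h
  have hind' : ∀ i j (hi : i < P.length) (hj : j < P.length), i + 1 < j → ¬ AdjT P[i] P[j] := by
    intro i j hi hj h
    exact hind ⟨i, hi⟩ ⟨j, hj⟩ h
  have hlen : 0 < P.length := List.length_pos_iff.2 hne
  have hhead : P.head hne = P[0] := by rw [List.head_eq_getElem]
  have hlast : P.getLast hne = P[P.length - 1] := by rw [List.getLast_eq_getElem]
  obtain ⟨k, hk, hk0⟩ := List.getElem_of_mem h0
  have hex0 : ∀ n : ℤ, 0 ≤ n → Hex (0 : ℤ × ℤ) n := by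
    intro n hn; simp only [Hex, Prod.fst_zero, Prod.snd_zero]; omega
  have haN : ¬ Hex P[0] (m + 10) := fun h => ha (by rw [hhead]; exact hex_mono h (by omega))
  have hbN : ¬ Hex P[P.length - 1] (m + 10) :=
    fun h => hb (by rw [hlast]; exact hex_mono h (by omega))
  -- first index in the ball
  obtain ⟨I, hIk, hI, hIout⟩ : ∃ I, ∃ h : I < k, OnH (P[I]) (m + 10) ∧
      ∀ t (ht : t < I), ¬ Hex P[t] (m + 10) := by
    have hex : ∃ t, ∃ h : t < P.length, Hex P[t] (m + 10) :=
      ⟨k, hk, by rw [hk0]; exact hex0 _ (by omega)⟩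
    have hmin : ∀ t (ht : t < Nat.find hex) (h : t < P.length), ¬ Hex P[t] (m + 10) := by
      intro t ht h hh
      exact Nat.find_min hex ht ⟨h, hh⟩
    obtain ⟨h1, h2⟩ := Nat.find_spec hex
    generalize Nat.find hex = I at *
    have hle : I ≤ k := by
      by_contra hlt
      exact hmin k (by omega) hk (by rw [hk0]; exact hex0 _ (by omega))
    have hpos : I ≠ 0 := by
      rintro rfl; exact haN h2
    obtain ⟨J, rfl⟩ := Nat.exists_eq_succ_of_ne_zero hpos
    have hon : OnH P[J + 1] (m + 10) := by
      refine ⟨h2, fun h => ?_⟩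
      apply hmin J (by omega) (by omega)
      have := hex_adj (hch' J (by omega)) h
      rwa [sub_add_cancel] at this
    refine ⟨J + 1, ?_, hon, fun t ht => hmin t ht _⟩
    rcases Nat.lt_or_eq_of_le hle with h | h
    · exact h
    · exfalso
      apply hon.2
      have : P[J + 1] = 0 := by rw [← hk0]; congr 1
      rw [this]; exact hex0 _ (by omega)
  -- last index in the ball
  obtain ⟨J, hkJ, hJl, hJ, hJout⟩ : ∃ J, ∃ _ : k < J, ∃ h : J < P.length, OnH (P[J]) (m + 10) ∧
      ∀ t (_ : J < t) (ht : t < P.length), ¬ Hex P[t] (m + 10) := by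
    have hex : ∃ s, ∃ h : P.length - 1 - s < P.length,
        Hex (P[P.length - 1 - s]) (m + 10) := by
      refine ⟨P.length - 1 - k, by omega, ?_⟩
      have : P[P.length - 1 - (P.length - 1 - k)]'(by omega) = 0 := by
        rw [← hk0]; congr 1; omega
      rw [this]; exact hex0 _ (by omega)
    have hmin : ∀ t (ht : t < P.length), P.length - 1 - t < Nat.find hex →
        ¬ Hex P[t] (m + 10) := by
      intro t ht h hh
      refine Nat.find_min hex h ⟨by omega, ?_⟩
      have : P[P.length - 1 - (P.length - 1 - t)]'(by omega) = P[t] := by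
        congr 1; omega
      rwa [this]
    obtain ⟨h1, h2⟩ := Nat.find_spec hex
    generalize Nat.find hex = s at *
    obtain ⟨J, hJ⟩ : ∃ J, J = P.length - 1 - s := ⟨_, rfl⟩
    have h2' : Hex (P[J]'(by omega)) (m + 10) := by subst hJ; exact h2
    have hle : k ≤ J := by
      by_contra hlt
      exact hmin k hk (by omega) (by rw [hk0]; exact hex0 _ (by omega))
    have hneJ : J ≠ P.length - 1 := by
      intro h; subst h; exact hbN h2'
    have hout : ∀ t (_ : J < t) (ht : t < P.length), ¬ Hex P[t] (m + 10) :=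
      fun t h ht => hmin t ht (by omega)
    have hon : OnH (P[J]'(by omega)) (m + 10) := by
      refine ⟨h2', fun h => ?_⟩
      apply hout (J + 1) (by omega) (by omega)
      have := hex_adj (adj_symm (hch' J (by omega))) h
      rwa [sub_add_cancel] at this
    refine ⟨J, ?_, by omega, hon, hout⟩
    rcases Nat.lt_or_eq_of_le hle with h | h
    · exact h
    · exfalso
      apply hon.2
      have : P[J]'(by omega) = 0 := by rw [← hk0]; congr 1; exact h.symm
      rw [this]; exact hex0 _ (by omega)
  have hIl : I < P.length := by omega
  obtain ⟨U, V, huU, hvV, hU, hV, hUV, haxis, ⟨e, heU, he0, her⟩, ⟨f, hfV, hf0, hfr⟩⟩ :=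
    geom m hm P[I] P[J] hI hJ (fun h => by have := hinj _ _ _ _ h; omega)
      (hind' I J hIl hJl (by omega))
  let S : Set (ℤ × ℤ) := {x | (x ∈ P ∧ ¬ Hex x (m + 10)) ∨ x ∈ U ∨ x ∈ V ∨ x = 0}
  have hUS : U ⊆ S := fun x hx => Or.inr (Or.inl hx)
  have hVS : V ⊆ S := fun x hx => Or.inr (Or.inr (Or.inl hx))
  have h0S : (0 : ℤ × ℤ) ∈ S := Or.inr (Or.inr (Or.inr rfl))
  have hPS : ∀ t (ht : t < P.length), ¬ Hex P[t] (m + 10) → P[t] ∈ S :=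
    fun t ht h => Or.inl ⟨List.getElem_mem ht, h⟩
  refine ⟨S, ?_, ?_, ?_, ?_⟩
  · intro x hx
    rw [ball_iff _ _ (by omega)] at hx
    constructor
    · rintro (h | h | h | rfl)
      · exact h.1
      · exact absurd (hU x h).1 hx
      · exact absurd (hV x h).1 hx
      · exact h0
    · intro h; exact Or.inl ⟨h, hx⟩
  · ext x
    constructor
    · rintro ⟨hxS, hxm⟩
      rw [ball_iff _ _ (by omega)] at hxm
      have h2 : x.2 = 0 := by
        rcases hxS with h | h | h | rfl
        · exact absurd (hex_mono hxm (by omega)) h.2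
        · exact (hU x h).2.2.2 hxm
        · exact (hV x h).2.2.2 hxm
        · rfl
      exact ⟨x.1, hxm.1, hxm.2.1, Prod.ext rfl h2⟩
    · rintro ⟨i, h1, h2, rfl⟩
      refine ⟨?_, ?_⟩
      · by_cases hi : i = 0
        · subst hi; exact h0S
        · rcases haxis i h1 h2 hi with h | h
          · exact hUS h
          · exact hVS h
      · rw [ball_iff _ _ (by omega)]
        simp only [Hex]; omega
  · have r1 : ∀ t (ht : t ≤ I), (GT S).Reachable P[0] (P[t]'(by omega)) := by
      intro t
      induction t with
      | zero => intro _; exact SimpleGraph.Reachable.refl _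
      | succ t ih =>
        intro ht
        refine (ih (by omega)).trans (GT_adj (hPS t _ (hIout t (by omega))) ?_ (hch' t (by omega)))
        by_cases htI : t + 1 = I
        · subst htI; exact hUS huU
        · exact hPS _ _ (hIout _ (by omega))
    have r2 : ∀ d (hd : J + d < P.length), (GT S).Reachable P[J] P[J + d] := by
      intro d
      induction d with
      | zero => intro _; exact SimpleGraph.Reachable.refl _
      | succ d ih =>
        intro hd
        refine (ih (by omega)).trans (GT_adj ?_ (hPS _ _ (hJout _ (by omega) _))
          (hch' (J + d) (by omega)))
        by_cases hd0 : d = 0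
        · subst hd0; exact hVS hvV
        · exact hPS _ _ (hJout _ (by omega) _)
    have r2' : (GT S).Reachable P[J] P[P.length - 1] := by
      have := r2 (P.length - 1 - J) (by omega)
      have h : P[J + (P.length - 1 - J)]'(by omega) = P[P.length - 1] := by congr 1; omega
      rwa [h] at this
    have rall : (GT S).Reachable (P.head hne) (P.getLast hne) := by
      rw [hhead, hlast]
      exact (r1 I le_rfl).trans <| (GT_mono hUS her).trans <| (GT_adj (hUS heU) h0S he0).trans <|
        (GT_adj h0S (hVS hfV) (adj_symm hf0)).trans <| (GT_mono hVS hfr).symm.trans r2'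
    obtain ⟨p, hp⟩ := rall.exists_isPath
    refine ⟨p.support, p.support_ne_nil, hp.support_nodup, ?_, ?_, p.head_support,
      p.getLast_support⟩
    · exact p.isChain_adj_support.imp (fun a b h => h.2.2)
    · intro x hx
      by_cases hx0 : x = P.head hne
      · rw [hx0, hhead]; exact hPS 0 hlen haN
      · have hS : P.head hne ∈ S := by rw [hhead]; exact hPS 0 hlen haN
        have gen : ∀ (a b : ℤ × ℤ) (q : (GT S).Walk a b), a ∈ S → ∀ y ∈ q.support, y ∈ S := by
          intro a b q
          induction q with
          | nil => intro ha y hy; simp only [SimpleGraph.Walk.support_nil, List.mem_singleton] at hy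
                   rwa [hy]
          | cons h q ih =>
            intro ha y hy
            rw [SimpleGraph.Walk.support_cons, List.mem_cons] at hy
            rcases hy with rfl | hy
            · exact ha
            · exact ih h.2.1 y hy
        exact gen _ _ p hS x hx
  · intro L hL hLnd hLch hLS hLh hLl
    by_contra h0L
    have hcl := chain_closed
      (fun x => (∃ t, ∃ h : t < k, x = P[t] ∧ ¬ Hex x (m + 10)) ∨ x ∈ U) S ?_ L hL hLch hLS h0L ?_
    · rw [hLl, hlast] at hcl
      rcases hcl with ⟨t, ht, h1, h2⟩ | h
      · have := hinj _ _ _ _ h1; omega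
      · exact hbN (hU _ h).1
    · rintro x y hx hy hy0 hxy
      have htouch : ∀ x y : ℤ × ℤ, AdjT x y → ¬ Hex x (m + 10) → ¬ Hex y (m + 10 - 1) := by
        intro x y h1 h2 h3
        have := hex_adj h1 h3
        rw [sub_add_cancel] at this
        exact h2 this
      rcases hx with ⟨t, ht, rfl, hxN⟩ | hx
      · rcases hy with ⟨hyP, hyN⟩ | hy | hy | hy
        · obtain ⟨t', ht', rfl⟩ := List.getElem_of_mem hyP
          by_cases h : t' < k
          · exact Or.inl ⟨t', h, rfl, hyN⟩
          · have : t' ≠ k := by rintro rfl; exact hy0 hk0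
            exact absurd hxy (hind' t t' _ _ (by omega))
        · exact Or.inr hy
        · have := (hV y hy).2.2.1 (htouch _ _ hxy hxN)
          subst this
          exact absurd hxy (hind' t J _ _ (by omega))
        · exact absurd hy hy0
      · rcases hy with ⟨hyP, hyN⟩ | hy | hy | hy
        · have := (hU x hx).2.2.1 (htouch _ _ (adj_symm hxy) hyN)
          subst this
          obtain ⟨t', ht', rfl⟩ := List.getElem_of_mem hyP
          by_cases h : t' < k
          · exact Or.inl ⟨t', h, rfl, hyN⟩
          · have : t' ≠ k := by rintro rfl; exact hy0 hk0
            exact absurd hxy (hind' I t' _ _ (by omega))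
        · exact Or.inr hy
        · exact absurd hxy (hUV x hx y hy)
        · exact absurd hy hy0
    · rw [hLh, hhead]
      exact Or.inl ⟨0, by omega, rfl, haN⟩
end
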